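/- Let 𝒜 be an abelian category and let 0 → A ⊕ B → C → D → 0 be a short exact sequence, with u : A → C and v : B → C the components of the first map and w : C → D the second map. Then v is a monomorphism, w∘u = 0 and w∘v = 0, and the induced sequence 0 → A → coker(v) → D → 0 — where the first map is u followed by the quotient map C → coker(v), and the second map is the morphism coker(v) → D induced by w — is a short exact sequence. (This is the abelian-category content of the statement that the mapping cone of the connecting map D → A[1] is isomorphic to the complex B → C sitting in degrees −2 and −1.) -/

import Mathlib

open CategoryTheory CategoryTheory.Limits

/-- Let `0 → A ⊕ B → C → D → 0` be a short exact sequence in an abelian category, with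
`u : A ⟶ C`, `v : B ⟶ C` the components of the first map and `w : C ⟶ D` the second
map.  Then `v` is a monomorphism, `u ≫ w = 0` and `v ≫ w = 0`, and the induced
sequence `0 → A → coker v → D → 0` — first map `u` followed by the quotient
`C ⟶ coker v`, second map induced by `w` — is a short exact sequence.  (This is the
abelian-category content of the statement that the mapping cone of the connecting map
`D → A[1]` is isomorphic to the complex `B → C` sitting in degrees `−2` and `−1`.) -/
theorem cone_of_connecting_map {𝒜 : Type*} [Category 𝒜] [Abelian 𝒜]
    {A B C D : 𝒜} (u : A ⟶ C) (v : B ⟶ C) (w : C ⟶ D)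
    (hz : biprod.desc u v ≫ w = 0)
    (hses : (ShortComplex.mk (biprod.desc u v) w hz).ShortExact) :
    Mono v ∧ u ≫ w = 0 ∧ v ≫ w = 0 ∧
    (ShortComplex.mk
      (u ≫ cokernel.π v)
      (cokernel.desc v w
        (by rw [← biprod.inr_desc u v, Category.assoc, hz, comp_zero]))
      (by
        rw [Category.assoc, cokernel.π_desc, ← biprod.inl_desc u v,
          Category.assoc, hz, comp_zero])).ShortExact := by
  have hmono : Mono (biprod.desc u v) := hses.mono_f
  have hepi : Epi w := hses.epi_g
  have hu : u ≫ w = 0 := by rw [← biprod.inl_desc u v, Category.assoc, hz, comp_zero]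
  have hv : v ≫ w = 0 := by rw [← biprod.inr_desc u v, Category.assoc, hz, comp_zero]
  have hmv : Mono v := by
    rw [← biprod.inr_desc u v]
    infer_instance
  refine ⟨hmv, hu, hv, ?_⟩
  have hmono' : Mono (u ≫ cokernel.π v) := by
    refine Preadditive.mono_of_cancel_zero _ fun {T} x hx => ?_
    have hx' : (x ≫ u) ≫ cokernel.π v = 0 := by rw [Category.assoc, hx]
    obtain ⟨y, hy⟩ : ∃ y : T ⟶ B, y ≫ v = x ≫ u :=
      ⟨Abelian.monoLift v (x ≫ u) hx', Abelian.monoLift_comp v (x ≫ u) hx'⟩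
    have hlift : biprod.lift x (-y) = 0 := by
      rw [← cancel_mono (biprod.desc u v), biprod.lift_desc, Preadditive.neg_comp, hy,
        add_neg_cancel, zero_comp]
    rw [← biprod.lift_fst x (-y), hlift, zero_comp]
  have hepi' : Epi (cokernel.desc v w hv) :=
    epi_of_epi_fac (cokernel.π_desc v w hv)
  refine ShortComplex.ShortExact.mk' ?_ hmono' hepi'
  rw [ShortComplex.exact_iff_exact_up_to_refinements]
  intro T x hx
  dsimp only at x hx ⊢
  obtain ⟨T', p, hp, c, hc⟩ := surjective_up_to_refinements_of_epi (cokernel.π v) x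
  have hcw : c ≫ w = 0 := by
    rw [← cokernel.π_desc v w hv, ← Category.assoc, ← hc, Category.assoc, hx, comp_zero]
  obtain ⟨y, hy⟩ : ∃ y : T' ⟶ A ⊞ B, y ≫ biprod.desc u v = c :=
    ⟨hses.exact.lift c hcw, hses.exact.lift_f c hcw⟩
  refine ⟨T', p, hp, y ≫ biprod.fst, ?_⟩
  rw [hc, ← hy, biprod.desc_eq]
  simp
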